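/- arXiv:1101.3282 — 2 statements merged into one kernel-verified Lean document; each statement's English description precedes it below -/
import Mathlib

section
/- Let Σ be a constant mean curvature surface in a Bianchi–Cartan–Vranceanu space M³_{m,l} with l² − 4m ≠ 0 whose unit normal ξ = c^γE_γ satisfies c³ ≠ 0, and suppose Σ satisfies the system |A|² − (4m − l²/2) − (l² − 4m)(c³)² = 0, (l² − 4m)c³a₁³ = 0, (l² − 4m)c³a₂³ = 0 (where e_i = a_i^γ E_γ is an adapted tangent frame). Then the tangent space of Σ equals span{E₁, E₂} everywhere, so the distribution spanned by {E₁,E₂} is involutive, forcing l = 0, ξ = ±E₃, and |A|² = 0, i.e., Σ is totally geodesic. -/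
/-!
Coordinate-based Riemannian geometry on charts `ℝⁿ`, enough to express mean
curvature, second fundamental forms, curvature tensors and the (bi)tension
fields of isometric immersions, as used in
"Constant mean curvature and totally umbilical biharmonic surfaces in
3-dimensional geometries".
-/

noncomputable section

open scoped BigOperators

/-- A point of the coordinate chart `ℝⁿ`. -/
abbrev Pt (n : ℕ) := Fin n → ℝ

/-- A Riemannian metric on (an open part of) `ℝⁿ`, given by its coordinate matrix. -/
abbrev Met (n : ℕ) := Pt n → Matrix (Fin n) (Fin n) ℝ

/-- A vector field on `ℝⁿ`, in coordinates. -/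
abbrev VF (n : ℕ) := Pt n → Pt n

/-- The inner product of tangent vectors `v`, `w` at the point `p`, w.r.t. `g`. -/
def gip {n : ℕ} (g : Met n) (p v w : Pt n) : ℝ := ∑ i, ∑ j, g p i j * v i * w j

/-- `g` is a Riemannian metric: smooth, symmetric and positive definite. -/
structure IsRiemannian {n : ℕ} (g : Met n) : Prop where
  smooth : ∀ i j, ContDiff ℝ (⊤ : ℕ∞) fun p => g p i j
  symm : ∀ p i j, g p i j = g p j i
  posdef : ∀ p v, v ≠ 0 → 0 < gip g p v v

/-- Christoffel symbols `Γ^k_{ij}` of the Levi-Civita connection of `g`. -/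
def christoffel {n : ℕ} (g : Met n) (p : Pt n) (k i j : Fin n) : ℝ :=
  (1 / 2) * ∑ l, (g p)⁻¹ k l *
    (fderiv ℝ (fun q => g q j l) p (Pi.single i 1)
      + fderiv ℝ (fun q => g q i l) p (Pi.single j 1)
      - fderiv ℝ (fun q => g q i j) p (Pi.single l 1))

/-- The Levi-Civita covariant derivative `∇_X Y` of vector fields, in coordinates. -/
def cov {n : ℕ} (g : Met n) (X Y : VF n) : VF n := fun p k =>
  fderiv ℝ (fun q => Y q k) p (X p) + ∑ i, ∑ j, christoffel g p k i j * X p i * Y p j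

/-- The Lie bracket `[X, Y]` of vector fields. -/
def lieB {n : ℕ} (X Y : VF n) : VF n := fun p k =>
  fderiv ℝ (fun q => Y q k) p (X p) - fderiv ℝ (fun q => X q k) p (Y p)

/-- The curvature operator `R(X,Y)Z = ∇_X ∇_Y Z − ∇_Y ∇_X Z − ∇_{[X,Y]} Z`. -/
def curvOp {n : ℕ} (g : Met n) (X Y Z : VF n) : VF n := fun p =>
  cov g X (cov g Y Z) p - cov g Y (cov g X Z) p - cov g (lieB X Y) Z p

/-- The curvature tensor evaluated on tangent vectors at `p` (via constant extensions). -/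
def curvPt {n : ℕ} (g : Met n) (p v w z : Pt n) : Pt n :=
  curvOp g (fun _ => v) (fun _ => w) (fun _ => z) p

/-- The Ricci curvature `Ric(v, w) = trace (z ↦ R(z, v) w)` at `p`; for the Levi-Civita
connection of a Riemannian metric this agrees with `Σᵢ ⟨R(v, eᵢ) eᵢ, w⟩` for any
orthonormal frame `{eᵢ}`. -/
def ricci {n : ℕ} (g : Met n) (p v w : Pt n) : ℝ :=
  ∑ k, curvPt g p (Pi.single k 1) v w k

/-- The differential of `φ` at `u`, applied to the `a`-th coordinate direction. -/
def dmap {m n : ℕ} (φ : Pt m → Pt n) (u : Pt m) (a : Fin m) : Pt n := fun k =>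
  fderiv ℝ (fun q => φ q k) u (Pi.single a 1)

/-- The pushforward `dφ_u(v)` of a tangent vector of the domain. -/
def push {m n : ℕ} (φ : Pt m → Pt n) (u : Pt m) (v : Pt m) : Pt n := fun k =>
  fderiv ℝ (fun q => φ q k) u v

/-- The first fundamental form (induced metric) of the immersion `φ`. -/
def fff {m n : ℕ} (g : Met n) (φ : Pt m → Pt n) : Met m := fun u =>
  Matrix.of fun a b => gip g (φ u) (dmap φ u a) (dmap φ u b)

/-- `φ` is a smooth immersion. -/
def IsImmersion {m n : ℕ} (φ : Pt m → Pt n) : Prop :=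
  (∀ k, ContDiff ℝ (⊤ : ℕ∞) fun u => φ u k) ∧ ∀ u, LinearIndependent ℝ (dmap φ u)

/-- `ξ` is a (smooth) unit normal vector field along the immersion `φ`. -/
def IsUnitNormal {m n : ℕ} (g : Met n) (φ ξ : Pt m → Pt n) : Prop :=
  (∀ k, ContDiff ℝ (⊤ : ℕ∞) fun u => ξ u k) ∧ (∀ u, gip g (φ u) (ξ u) (ξ u) = 1) ∧
    ∀ u a, gip g (φ u) (ξ u) (dmap φ u a) = 0

/-- The second fundamental form `h_{ab} = ⟨∇^N_{∂_a} dφ(∂_b), ξ⟩` of `φ` w.r.t. `ξ`. -/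
def sff {m n : ℕ} (g : Met n) (φ ξ : Pt m → Pt n) (u : Pt m) (a b : Fin m) : ℝ :=
  gip g (φ u)
    (fun k => fderiv ℝ (fun q => dmap φ q b k) u (Pi.single a 1)
      + ∑ i, ∑ j, christoffel g (φ u) k i j * dmap φ u a i * dmap φ u b j)
    (ξ u)

/-- The shape operator `A^a_b = G^{ac} h_{cb}` of `φ` w.r.t. `ξ` (`G` the induced metric). -/
def shapeOp {m n : ℕ} (g : Met n) (φ ξ : Pt m → Pt n) (u : Pt m) (a b : Fin m) : ℝ :=
  ∑ c, (fff g φ u)⁻¹ a c * sff g φ ξ u c b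

/-- The mean curvature `H = (1/m) ⋅ trace A` of the hypersurface `φ` w.r.t. `ξ`. -/
def meanCurv {m n : ℕ} (g : Met n) (φ ξ : Pt m → Pt n) (u : Pt m) : ℝ :=
  (1 / (m : ℝ)) * ∑ a, shapeOp g φ ξ u a a

/-- The squared norm `|A|²` of the shape operator (= of the second fundamental form). -/
def normA2 {m n : ℕ} (g : Met n) (φ ξ : Pt m → Pt n) (u : Pt m) : ℝ :=
  ∑ a, ∑ b, shapeOp g φ ξ u a b * shapeOp g φ ξ u b a

/-- `φ` is totally umbilical w.r.t. `ξ`: at every point both principal curvatures are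
equal, i.e. the second fundamental form is a scalar multiple of the induced metric
(equivalently, the shape operator is a scalar multiple of the identity). -/
def IsTotallyUmbilical {m n : ℕ} (g : Met n) (φ ξ : Pt m → Pt n) : Prop :=
  ∃ lam : Pt m → ℝ, ∀ u a b, sff g φ ξ u a b = lam u * fff g φ u a b

/-- The tension field `τ(φ) = Trace_g ∇ dφ` of the isometric immersion `φ`
(the domain carrying the induced metric). -/
def tension {m n : ℕ} (g : Met n) (φ : Pt m → Pt n) (u : Pt m) : Pt n := fun k =>
  ∑ a, ∑ b, (fff g φ u)⁻¹ a b *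
    (fderiv ℝ (fun q => dmap φ q b k) u (Pi.single a 1)
      - ∑ c, christoffel (fff g φ) u c a b * dmap φ u c k
      + ∑ i, ∑ j, christoffel g (φ u) k i j * dmap φ u a i * dmap φ u b j)

/-- The pull-back covariant derivative `∇^φ_{∂_a} V` of a vector field `V` along `φ`. -/
def covAlong {m n : ℕ} (g : Met n) (φ : Pt m → Pt n) (V : Pt m → Pt n) (a : Fin m) :
    Pt m → Pt n := fun u k =>
  fderiv ℝ (fun q => V q k) u (Pi.single a 1)
    + ∑ i, ∑ j, christoffel g (φ u) k i j * dmap φ u a i * V u j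

/-- The bitension field
`τ₂(φ) = Trace_g (∇^φ ∇^φ − ∇^φ_{∇^M}) τ(φ) − Trace_g R^N(dφ, τ(φ)) dφ`. -/
def bitension {m n : ℕ} (g : Met n) (φ : Pt m → Pt n) (u : Pt m) : Pt n := fun k =>
  (∑ a, ∑ b, (fff g φ u)⁻¹ a b *
      (covAlong g φ (covAlong g φ (tension g φ) b) a u k
        - ∑ c, christoffel (fff g φ) u c a b * covAlong g φ (tension g φ) c u k))
    - ∑ a, ∑ b, (fff g φ u)⁻¹ a b *
        curvPt g (φ u) (dmap φ u a) (tension g φ u) (dmap φ u b) k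

/-- `φ` is a biharmonic isometric immersion: its bitension field vanishes.  (This is the
Euler–Lagrange characterisation of the critical points of the bienergy
`E²(φ,Ω) = (1/2)∫_Ω |τ(φ)|²` for every compact `Ω`.) -/
def IsBiharmonic {m n : ℕ} (g : Met n) (φ : Pt m → Pt n) : Prop := ∀ u, bitension g φ u = 0

/-- `φ` is minimal (equivalently, harmonic): its tension field vanishes, i.e. `H ≡ 0`. -/
def IsMinimal {m n : ℕ} (g : Met n) (φ : Pt m → Pt n) : Prop := ∀ u, tension g φ u = 0

/-- `φ` is proper biharmonic: biharmonic and not minimal. -/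
def IsProperBiharmonic {m n : ℕ} (g : Met n) (φ : Pt m → Pt n) : Prop :=
  IsBiharmonic g φ ∧ ¬IsMinimal g φ

/-! ### The Bianchi–Cartan–Vranceanu spaces `M³_{m,l}`, Sol, hyperbolic and flat space -/

/-- `F = 1 + m (x² + y²)`. -/
def bcvF (m : ℝ) (p : Pt 3) : ℝ := 1 + m * (p 0 ^ 2 + p 1 ^ 2)

/-- The coordinate covector of the one-form `dz + (l/2)(y dx − x dy)/F`. -/
def bcvω (m l : ℝ) (p : Pt 3) : Pt 3 :=
  ![l * p 1 / (2 * bcvF m p), -(l * p 0) / (2 * bcvF m p), 1]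

/-- The Bianchi–Cartan–Vranceanu metric
`g = (dx² + dy²)/(1 + m(x²+y²))² + (dz + (l/2)(y dx − x dy)/(1 + m(x²+y²)))²` on `ℝ³`. -/
def bcvMet (m l : ℝ) : Met 3 := fun p =>
  Matrix.of fun i j =>
    (if i = j ∧ (i : ℕ) < 2 then 1 / bcvF m p ^ 2 else 0) + bcvω m l p i * bcvω m l p j

/-- The frame `E₁ = F ∂_x − (l y/2) ∂_z`, `E₂ = F ∂_y + (l x/2) ∂_z`, `E₃ = ∂_z`
on the BCV space `M³_{m,l}`. -/
def bcvE (m l : ℝ) : Fin 3 → VF 3 :=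
  ![fun p => ![bcvF m p, 0, -(l * p 1) / 2],
    fun p => ![0, bcvF m p, l * p 0 / 2],
    fun _ => ![0, 0, 1]]

/-- The base metric `h = (dx² + dy²)/(1 + m(x²+y²))²` on `ℝ²` of the BCV Riemannian
submersion `π : M³_{m,l} → (ℝ², h)`, `π(x,y,z) = (x,y)`. -/
def bcvBase (m : ℝ) : Met 2 := fun p =>
  Matrix.of fun i j => if i = j then 1 / (1 + m * (p 0 ^ 2 + p 1 ^ 2)) ^ 2 else 0

/-- The geodesic curvature of a unit-speed curve `α` in `(ℝ², h)`, with respect to the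
unit normal obtained by rotating `α'` by `+π/2` (a Euclidean rotation, which is also an
`h`-rotation since `h` is conformal to the flat metric). -/
def geodCurv (m : ℝ) (α : ℝ → Pt 2) (s : ℝ) : ℝ :=
  gip (bcvBase m) (α s)
    (fun k => deriv (fun t => deriv α t k) s
      + ∑ i, ∑ j, christoffel (bcvBase m) (α s) k i j * deriv α s i * deriv α s j)
    ![-deriv α s 1, deriv α s 0]

/-- `φ` parametrises part of the Hopf cylinder `π⁻¹(α(I))` over a circle of radius
`1/√(8m − l²)` in the base sphere `S²(1/(2√m))`, identified with `(ℝ², h)`.  (In the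
base sphere, which has Gaussian curvature `4m` and extrinsic normal curvature `2√m`,
the circles of radius `1/√(8m − l²)` are exactly the curves of constant geodesic
curvature `κ₀` with `κ₀² = (8m − l²) − 4m = 4m − l²`.) -/
def PartOfHopfCylinderOverCircle (m l : ℝ) (φ : Pt 2 → Pt 3) : Prop :=
  ∃ α : ℝ → Pt 2, ContDiff ℝ (⊤ : ℕ∞) α ∧
    (∀ s, gip (bcvBase m) (α s) (deriv α s) (deriv α s) = 1) ∧
    (∃ κ₀ : ℝ, κ₀ ^ 2 = 4 * m - l ^ 2 ∧ ∀ s, geodCurv m α s = κ₀) ∧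
    ∀ u, ∃ s, φ u 0 = α s 0 ∧ φ u 1 = α s 1

/-- The Sol metric `g_{Sol} = e^{2z} dx² + e^{−2z} dy² + dz²` on `ℝ³`. -/
def solMet : Met 3 := fun p =>
  Matrix.of fun i j =>
    if i = j then
      if (i : ℕ) = 0 then Real.exp (2 * p 2)
      else if (i : ℕ) = 1 then Real.exp (-(2 * p 2)) else 1
    else 0

/-- The orthonormal frame `E₁ = e^{−z} ∂_x`, `E₂ = e^{z} ∂_y`, `E₃ = ∂_z` on Sol space. -/
def solE : Fin 3 → VF 3 :=
  ![fun p => ![Real.exp (-p 2), 0, 0],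
    fun p => ![0, Real.exp (p 2), 0],
    fun _ => ![0, 0, 1]]

/-- Hyperbolic 3-space `H³` in horospherical coordinates: `g = e^{2z}(dx² + dy²) + dz²`. -/
def hypMet : Met 3 := fun p =>
  Matrix.of fun i j => if i = j then (if (i : ℕ) < 2 then Real.exp (2 * p 2) else 1) else 0

/-- The flat metric on `ℝ³`. -/
def euclMet : Met 3 := fun _ => 1

/-- Auxiliary: the contact form evaluated on a vector. -/
def omv (m l : ℝ) (p v : Pt 3) : ℝ :=
  l * p 1 / (2 * bcvF m p) * v 0 + -(l * p 0) / (2 * bcvF m p) * v 1 + v 2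

theorem gip_bcv (m l : ℝ) (p v w : Pt 3) :
    gip (bcvMet m l) p v w =
      (v 0 * w 0 + v 1 * w 1) / bcvF m p ^ 2 + omv m l p v * omv m l p w := by
  simp [gip, bcvMet, Fin.sum_univ_three, omv, bcvω]
  ring

theorem comb0 (m l : ℝ) (p : Pt 3) (a : Fin 3 → ℝ) :
    (∑ γ, a γ • bcvE m l γ p) 0 = a 0 * bcvF m p := by
  simp [Fin.sum_univ_three, bcvE]

theorem comb1 (m l : ℝ) (p : Pt 3) (a : Fin 3 → ℝ) :
    (∑ γ, a γ • bcvE m l γ p) 1 = a 1 * bcvF m p := by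
  simp [Fin.sum_univ_three, bcvE]

theorem comb2 (m l : ℝ) (p : Pt 3) (a : Fin 3 → ℝ) :
    (∑ γ, a γ • bcvE m l γ p) 2 = a 0 * (-(l * p 1) / 2) + a 1 * (l * p 0 / 2) + a 2 := by
  simp [Fin.sum_univ_three, bcvE]

theorem omv_comb (m l : ℝ) (p : Pt 3) (hF : bcvF m p ≠ 0) (a : Fin 3 → ℝ) :
    omv m l p (∑ γ, a γ • bcvE m l γ p) = a 2 := by
  rw [omv, comb0, comb1, comb2]
  field_simp
  ring

theorem push_eq (φ : Pt 2 → Pt 3) (u v : Pt 2) (k : Fin 3) :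
    push φ u v k = v 0 * dmap φ u 0 k + v 1 * dmap φ u 1 k := by
  have hv : v = v 0 • (Pi.single 0 1 : Pt 2) + v 1 • (Pi.single 1 1 : Pt 2) := by
    ext i; fin_cases i <;> simp
  unfold push dmap
  conv_lhs => rw [hv]
  rw [map_add, map_smul, map_smul, smul_eq_mul, smul_eq_mul]

theorem fderiv_zero_of_const {n : ℕ} (f : Pt n → ℝ) (p e : Pt n)
    (h : ∀ t : ℝ, f (p + t • e) = f p) : fderiv ℝ f p e = 0 := by
  by_cases hd : DifferentiableAt ℝ f p
  · rw [← hd.lineDeriv_eq_fderiv]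
    simp [lineDeriv, h]
  · simp [fderiv_zero_of_not_differentiableAt hd]

theorem second_symm (φ : Pt 2 → Pt 3) (hφ : IsImmersion φ) (u : Pt 2) (k : Fin 3)
    (a b : Fin 2) :
    fderiv ℝ (fun q => dmap φ q b k) u (Pi.single a 1)
      = fderiv ℝ (fun q => dmap φ q a k) u (Pi.single b 1) := by
  have hk := hφ.1 k
  have hs : IsSymmSndFDerivAt ℝ (fun q => φ q k) u :=
    (hk.contDiffAt).isSymmSndFDerivAt (by simp; exact WithTop.coe_le_coe.2 (le_top : (2 : ℕ∞) ≤ ⊤))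
  have hd : DifferentiableAt ℝ (fderiv ℝ (fun q => φ q k)) u :=
    ((hk.fderiv_right (m := 1) (by norm_cast)).differentiable (by simp)) u
  have key : ∀ c d : Fin 2, fderiv ℝ (fun q => dmap φ q c k) u (Pi.single d 1)
      = fderiv ℝ (fderiv ℝ (fun q => φ q k)) u (Pi.single d 1) (Pi.single c 1) := by
    intro c d
    unfold dmap
    rw [fderiv_clm_apply hd (differentiableAt_const _)]
    simp
  rw [key, key]
  exact hs _ _

theorem dmap_diff (φ : Pt 2 → Pt 3) (hφ : IsImmersion φ) (u : Pt 2) (k : Fin 3) (a : Fin 2) :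
    DifferentiableAt ℝ (fun q => dmap φ q a k) u := by
  have hd : DifferentiableAt ℝ (fderiv ℝ (fun q => φ q k)) u :=
    (((hφ.1 k).fderiv_right (m := 1) (by norm_cast)).differentiable (by simp)) u
  exact hd.clm_apply (differentiableAt_const _)

theorem jac_ne (m l : ℝ) (φ : Pt 2 → Pt 3) (hφ : IsImmersion φ) (u : Pt 2)
    (h : ∀ a, omv m l (φ u) (dmap φ u a) = 0) :
    dmap φ u 0 0 * dmap φ u 1 1 - dmap φ u 1 0 * dmap φ u 0 1 ≠ 0 := by
  intro hJ
  have hli : ∀ s t : ℝ, (∀ k, s * dmap φ u 0 k + t * dmap φ u 1 k = 0) → s = 0 ∧ t = 0 := by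
    intro s t hst
    have := Fintype.linearIndependent_iff.1 (hφ.2 u) ![s, t] (by
      funext k
      simpa [Fin.sum_univ_two] using hst k)
    exact ⟨this 0, this 1⟩
  have h0 := h 0
  have h1 := h 1
  unfold omv at h0 h1
  generalize l * φ u 1 / (2 * bcvF m (φ u)) = P at h0 h1
  generalize -(l * φ u 0) / (2 * bcvF m (φ u)) = Q at h0 h1
  obtain ⟨y1, y0⟩ := hli (dmap φ u 1 1) (-dmap φ u 0 1) (by
    intro k
    fin_cases k <;> simp
    · linear_combination hJ
    · ring
    · linear_combination dmap φ u 1 1 * h0 - dmap φ u 0 1 * h1 - P * hJ)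
  obtain ⟨x1, x0⟩ := hli (dmap φ u 1 0) (-dmap φ u 0 0) (by
    intro k
    fin_cases k <;> simp
    · ring
    · linear_combination -hJ
    · linear_combination dmap φ u 1 0 * h0 - dmap φ u 0 0 * h1 + Q * hJ)
  have z0 : dmap φ u 0 2 = 0 := by
    linear_combination h0 + P * x0 + Q * y0
  have := hli 1 0 (by
    intro k
    fin_cases k <;> simp
    · linear_combination -x0
    · linear_combination -y0
    · exact z0)
  exact one_ne_zero this.1

theorem diff_rel (m l : ℝ) (φ : Pt 2 → Pt 3) (hφ : IsImmersion φ)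
    (hdom : ∀ u, 0 < bcvF m (φ u))
    (h : ∀ u a, omv m l (φ u) (dmap φ u a) = 0) (u : Pt 2) (a b : Fin 2) :
    2 * (2 * m * (φ u 0 * dmap φ u b 0 + φ u 1 * dmap φ u b 1)) * dmap φ u a 2
      + 2 * bcvF m (φ u) * fderiv ℝ (fun q => dmap φ q a 2) u (Pi.single b 1)
      + l * (dmap φ u b 1 * dmap φ u a 0
          + φ u 1 * fderiv ℝ (fun q => dmap φ q a 0) u (Pi.single b 1)
        - dmap φ u b 0 * dmap φ u a 1
          - φ u 0 * fderiv ℝ (fun q => dmap φ q a 1) u (Pi.single b 1)) = 0 := by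
  have h0 : (fun q => 2 * (1 + m * (φ q 0 * φ q 0 + φ q 1 * φ q 1)) * dmap φ q a 2
      + l * (φ q 1 * dmap φ q a 0 - φ q 0 * dmap φ q a 1)) = fun _ => (0 : ℝ) := by
    funext q
    have hq := h q a
    have hF := (hdom q).ne'
    have hFd : bcvF m (φ q) = 1 + m * (φ q 0 * φ q 0 + φ q 1 * φ q 1) := by
      unfold bcvF; ring
    rw [omv] at hq
    rw [← hFd]
    field_simp at hq
    linear_combination hq
  have dφ : ∀ k, HasFDerivAt (fun q => φ q k) (fderiv ℝ (fun q => φ q k) u) u := fun k =>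
    (((hφ.1 k).differentiable (by simp)) u).hasFDerivAt
  have dd : ∀ k, HasFDerivAt (fun q => dmap φ q a k) (fderiv ℝ (fun q => dmap φ q a k) u) u :=
    fun k => (dmap_diff φ hφ u k a).hasFDerivAt
  have H := ((((((((dφ 0).mul (dφ 0)).add ((dφ 1).mul (dφ 1))).const_mul m).const_add 1).const_mul
    2).mul (dd 2)).add ((((dφ 1).mul (dd 0)).sub ((dφ 0).mul (dd 1))).const_mul l))
  have H' := H.congr_of_eventuallyEq (f₁ := fun _ => (0 : ℝ)) (by
    rw [← h0]; exact Filter.Eventually.of_forall fun q => rfl)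
  have H2 := H'.unique (hasFDerivAt_const (0 : ℝ) u)
  have H3 := congrArg (fun L => L (Pi.single b 1)) H2
  have e : ∀ k, fderiv ℝ (fun q => φ q k) u (Pi.single b 1) = dmap φ u b k := fun k => rfl
  simp [e] at H3
  unfold bcvF
  linear_combination H3

theorem christ_zero (m : ℝ) (p : Pt 3) (hF : bcvF m p ≠ 0) (i j : Fin 3) :
    christoffel (bcvMet m 0) p 2 i j = 0 := by
  have hinv : (bcvMet m 0 p)⁻¹ =
      Matrix.diagonal ![bcvF m p ^ 2, bcvF m p ^ 2, 1] := by
    apply Matrix.inv_eq_right_inv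
    ext a b
    fin_cases a <;> fin_cases b <;>
      simp [bcvMet, bcvω, Matrix.mul_apply, Fin.sum_univ_three, Matrix.diagonal, hF]
  have hc2 : ∀ a : Fin 3, (fun q : Pt 3 => bcvMet m 0 q a 2) = fun _ => if a = 2 then 1 else 0 := by
    intro a; funext q
    fin_cases a <;> simp [bcvMet, bcvω]
  have h3 : fderiv ℝ (fun q => bcvMet m 0 q i j) p (Pi.single 2 1) = 0 := by
    apply fderiv_zero_of_const
    intro t
    simp [bcvMet, bcvω, bcvF]
  unfold christoffel
  rw [hinv]
  simp [Fin.sum_univ_three, Matrix.diagonal, hc2, h3]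

/-- Let `Σ` be a constant mean curvature surface in a BCV space
`M³_{m,l}` with `l² − 4m ≠ 0`, with adapted orthonormal frame
`{e₁ = a₁^γ E_γ, e₂ = a₂^γ E_γ, ξ = c^γ E_γ}` whose unit normal satisfies `c³ ≠ 0`.
If `Σ` satisfies the system `|A|² − (4m − l²/2) − (l² − 4m)(c³)² = 0`,
`(l² − 4m) c³ a₁³ = 0`, `(l² − 4m) c³ a₂³ = 0`, then the tangent space of `Σ` equals
`span{E₁, E₂}` everywhere (so the distribution spanned by `{E₁,E₂}` is integrable, hence
involutive), forcing `l = 0`, `ξ = ±E₃` and `|A|² = 0`, i.e. `Σ` is totally geodesic. -/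
theorem bcv_cmc_biharmonic_normal_component_case
    (m l : ℝ) (φ ξ e₁ e₂ : Pt 2 → Pt 3) (a₁ a₂ c : Pt 2 → Fin 3 → ℝ)
    (hφ : IsImmersion φ) (hdom : ∀ u, 0 < bcvF m (φ u))
    (he₁ : ∀ u, e₁ u = ∑ γ, a₁ u γ • bcvE m l γ (φ u))
    (he₂ : ∀ u, e₂ u = ∑ γ, a₂ u γ • bcvE m l γ (φ u))
    (hc : ∀ u, ξ u = ∑ γ, c u γ • bcvE m l γ (φ u))
    (horth : ∀ u, gip (bcvMet m l) (φ u) (e₁ u) (e₁ u) = 1 ∧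
      gip (bcvMet m l) (φ u) (e₂ u) (e₂ u) = 1 ∧
      gip (bcvMet m l) (φ u) (e₁ u) (e₂ u) = 0)
    (htan₁ : ∀ u, ∃ v : Pt 2, push φ u v = e₁ u)
    (htan₂ : ∀ u, ∃ v : Pt 2, push φ u v = e₂ u)
    (hξ : IsUnitNormal (bcvMet m l) φ ξ)
    (H₀ : ℝ) (hH : ∀ u, meanCurv (bcvMet m l) φ ξ u = H₀)
    (hml : l ^ 2 - 4 * m ≠ 0) (hc3 : ∀ u, c u 2 ≠ 0)
    (hsys : ∀ u,
      normA2 (bcvMet m l) φ ξ u - (4 * m - l ^ 2 / 2) - (l ^ 2 - 4 * m) * c u 2 ^ 2 = 0 ∧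
      (l ^ 2 - 4 * m) * c u 2 * a₁ u 2 = 0 ∧
      (l ^ 2 - 4 * m) * c u 2 * a₂ u 2 = 0) :
    (∀ u, Submodule.span ℝ ({dmap φ u 0, dmap φ u 1} : Set (Pt 3))
        = Submodule.span ℝ ({bcvE m l 0 (φ u), bcvE m l 1 (φ u)} : Set (Pt 3))) ∧
    l = 0 ∧
    (∀ u, ξ u = bcvE m l 2 (φ u) ∨ ξ u = -bcvE m l 2 (φ u)) ∧
    (∀ u i j, sff (bcvMet m l) φ ξ u i j = 0) := by
  have hom : ∀ u a, omv m l (φ u) (dmap φ u a) = 0 := by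
    intro u
    have hF := (hdom u).ne'
    obtain ⟨v, hv⟩ := htan₁ u
    obtain ⟨w, hw⟩ := htan₂ u
    obtain ⟨-, h1, h2⟩ := hsys u
    have ha1 : a₁ u 2 = 0 := by
      simpa [hml, hc3 u] using h1
    have ha2 : a₂ u 2 = 0 := by
      simpa [hml, hc3 u] using h2
    have o1 : omv m l (φ u) (e₁ u) = 0 := by rw [he₁, omv_comb _ _ _ hF, ha1]
    have o2 : omv m l (φ u) (e₂ u) = 0 := by rw [he₂, omv_comb _ _ _ hF, ha2]
    obtain ⟨g1, g2, g3⟩ := horth u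
    rw [gip_bcv, o1] at g1
    rw [gip_bcv, o2] at g2
    rw [gip_bcv, o1] at g3
    have E1 : ∀ k, e₁ u k = v 0 * dmap φ u 0 k + v 1 * dmap φ u 1 k := fun k => by
      rw [← hv, push_eq]
    have E2 : ∀ k, e₂ u k = w 0 * dmap φ u 0 k + w 1 * dmap φ u 1 k := fun k => by
      rw [← hw, push_eq]
    simp only [omv, E1, E2] at o1 o2 g1 g2 g3
    have hD : v 0 * w 1 - v 1 * w 0 ≠ 0 := by
      intro hD
      have k : (1 : ℝ) * 1 - 0 * 0 = (v 0 * w 1 - v 1 * w 0) ^ 2 *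
          ((dmap φ u 0 0 * dmap φ u 1 1 - dmap φ u 1 0 * dmap φ u 0 1) / bcvF m (φ u) ^ 2) ^ 2 := by
        conv_lhs => rw [← g3]
        nth_rewrite 1 [← g1]
        rw [← g2]
        ring
      rw [hD] at k
      norm_num at k
    have hA : omv m l (φ u) (dmap φ u 0) = 0 := by
      apply mul_left_cancel₀ hD
      unfold omv
      linear_combination w 1 * o1 - v 1 * o2
    have hB : omv m l (φ u) (dmap φ u 1) = 0 := by
      apply mul_left_cancel₀ hD
      unfold omv
      linear_combination v 0 * o2 - w 0 * o1
    intro a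
    fin_cases a
    · exact hA
    · exact hB
  have hz : ∀ u a, 2 * bcvF m (φ u) * dmap φ u a 2
      = -l * (φ u 1 * dmap φ u a 0 - φ u 0 * dmap φ u a 1) := by
    intro u a
    have h := hom u a
    have hF := (hdom u).ne'
    unfold omv at h
    field_simp at h
    linear_combination h
  have hJ := fun u => jac_ne m l φ hφ u (hom u)
  have hl : l = 0 := by
    have r1 := diff_rel m l φ hφ hdom hom 0 0 1
    have r2 := diff_rel m l φ hφ hdom hom 0 1 0
    rw [second_symm φ hφ 0 2 0 1, second_symm φ hφ 0 1 0 1, second_symm φ hφ 0 0 0 1] at r2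
    have z0 := hz 0 0
    have z1 := hz 0 1
    have hF : bcvF m (φ 0) = 1 + m * (φ 0 0 ^ 2 + φ 0 1 ^ 2) := rfl
    generalize bcvF m (φ 0) = F at *
    have : l * (dmap φ 0 0 0 * dmap φ 0 1 1 - dmap φ 0 1 0 * dmap φ 0 0 1) = 0 := by
      linear_combination (F * (r1 - r2) - 2 * m * (φ 0 0 * dmap φ 0 1 0 + φ 0 1 * dmap φ 0 1 1) * z0
        + 2 * m * (φ 0 0 * dmap φ 0 0 0 + φ 0 1 * dmap φ 0 0 1) * z1) / 2
        - l * (dmap φ 0 0 0 * dmap φ 0 1 1 - dmap φ 0 1 0 * dmap φ 0 0 1) * hF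
    exact (mul_eq_zero.1 this).resolve_right (hJ 0)
  have hξ01 : ∀ u, ξ u = c u 2 • bcvE m l 2 (φ u) ∧ c u 2 ^ 2 = 1 := by
    intro u
    have hF := (hdom u).ne'
    have n1 := hξ.2.1 u
    have n2 := hξ.2.2 u 0
    have n3 := hξ.2.2 u 1
    rw [gip_bcv, hom, mul_zero, add_zero, div_eq_zero_iff, or_iff_left (pow_ne_zero 2 hF)] at n2 n3
    have x0 : ξ u 0 = 0 := by
      apply mul_left_cancel₀ (hJ u)
      linear_combination dmap φ u 1 1 * n2 - dmap φ u 0 1 * n3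
    have x1 : ξ u 1 = 0 := by
      apply mul_left_cancel₀ (hJ u)
      linear_combination dmap φ u 0 0 * n3 - dmap φ u 1 0 * n2
    have o : omv m l (φ u) (ξ u) = c u 2 := by rw [hc, omv_comb _ _ _ hF]
    rw [gip_bcv, o, x0, x1] at n1
    rw [hc, comb0] at x0
    rw [hc, comb1] at x1
    have c0 := (mul_eq_zero.1 x0).resolve_right hF
    have c1 := (mul_eq_zero.1 x1).resolve_right hF
    refine ⟨?_, by simpa [sq] using n1⟩
    rw [hc, Fin.sum_univ_three, c0, c1]
    simp
  subst hl
  have hz0 : ∀ u a, dmap φ u a 2 = 0 := by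
    intro u a
    have h := hz u a
    have hF := (hdom u).ne'
    simpa [hF] using h
  refine ⟨?_, rfl, ?_, ?_⟩
  · intro u
    have hF := (hdom u).ne'
    apply le_antisymm
    · rw [Submodule.span_le]
      have key : ∀ a, dmap φ u a ∈
          Submodule.span ℝ ({bcvE m 0 0 (φ u), bcvE m 0 1 (φ u)} : Set (Pt 3)) := by
        intro a
        rw [Submodule.mem_span_pair]
        refine ⟨dmap φ u a 0 / bcvF m (φ u), dmap φ u a 1 / bcvF m (φ u), ?_⟩
        ext k
        fin_cases k <;> simp [bcvE, hz0, hF]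
      rintro x (rfl | rfl)
      · exact key 0
      · exact key 1
    · rw [Submodule.span_le]
      have hJu := hJ u
      rintro x (rfl | rfl)
      · rw [SetLike.mem_coe, Submodule.mem_span_pair]
        refine ⟨bcvF m (φ u) * dmap φ u 1 1 /
          (dmap φ u 0 0 * dmap φ u 1 1 - dmap φ u 1 0 * dmap φ u 0 1),
          -(bcvF m (φ u) * dmap φ u 0 1) /
          (dmap φ u 0 0 * dmap φ u 1 1 - dmap φ u 1 0 * dmap φ u 0 1), ?_⟩
        ext k
        generalize hJe : dmap φ u 0 0 * dmap φ u 1 1 - dmap φ u 1 0 * dmap φ u 0 1 = J at hJu ⊢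
        fin_cases k <;> simp [bcvE, hz0] <;> field_simp <;> grind
      · rw [SetLike.mem_coe, Submodule.mem_span_pair]
        refine ⟨-(bcvF m (φ u) * dmap φ u 1 0) /
          (dmap φ u 0 0 * dmap φ u 1 1 - dmap φ u 1 0 * dmap φ u 0 1),
          (bcvF m (φ u) * dmap φ u 0 0) /
          (dmap φ u 0 0 * dmap φ u 1 1 - dmap φ u 1 0 * dmap φ u 0 1), ?_⟩
        ext k
        generalize hJe : dmap φ u 0 0 * dmap φ u 1 1 - dmap φ u 1 0 * dmap φ u 0 1 = J at hJu ⊢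
        fin_cases k <;> simp [bcvE, hz0] <;> field_simp <;> grind
  · intro u
    obtain ⟨h1, h2⟩ := hξ01 u
    rcases sq_eq_one_iff.1 h2 with h | h <;> rw [h] at h1
    · left; simpa using h1
    · right; simpa using h1
  · intro u i j
    have hx := (hξ01 u).1
    have x0 : ξ u 0 = 0 := by rw [hx]; simp [bcvE]
    have x1 : ξ u 1 = 0 := by rw [hx]; simp [bcvE]
    have hf : (fun q => dmap φ q j 2) = fun _ => (0 : ℝ) := funext fun q => hz0 q j
    have hch := christ_zero m (φ u) (hdom u).ne'
    unfold sff
    rw [gip_bcv, x0, x1]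
    simp only [omv, hf]
    simp [Fin.sum_univ_three, hz0, hch]
end
end

section
/- Let α(s) = (x(s), y(s)) be an arclength-parametrized curve in (ℝ², h = (dx²+dy²)/[1+m(x²+y²)]²) with geodesic curvature κ_g, and let Σ = ∪_s π^{-1}(α(s)) be its Hopf cylinder in the Bianchi–Cartan–Vranceanu space M³_{m,l}, with adapted frame X = (x'/F)E₁ + (y'/F)E₂, ξ = (y'/F)E₁ − (x'/F)E₂, V = E₃ (F = 1+m(x²+y²)). Then Ric(ξ,ξ) = 4m − l²/2, Ric(ξ,X) = Ric(ξ,V) = 0, the torsion of the fibers is τ_g = −⟨∇_X V, ξ⟩ = −l/2, and Σ is biharmonic if and only if κ_g'' − κ_g³ + (4m − l²)κ_g = 0, 3κ_gκ_g' = 0, and (l/2)κ_g' = 0; hence either κ_g ≡ 0 (Σ minimal) or κ_g is constant with κ_g² = 4m − l². -/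
/-!
Coordinate-based Riemannian geometry on charts `ℝⁿ`, enough to express mean
curvature, second fundamental forms, curvature tensors and the (bi)tension
fields of isometric immersions, as used in
"Constant mean curvature and totally umbilical biharmonic surfaces in
3-dimensional geometries".
-/

noncomputable section

open scoped BigOperators

/-- `f` is differentiable at `p` with directional derivative `d` along `v`. -/
def HD {n : ℕ} (f : Pt n → ℝ) (p v : Pt n) (d : ℝ) : Prop :=
  DifferentiableAt ℝ f p ∧ fderiv ℝ f p v = d

section HDrules
variable {n : ℕ} {f g : Pt n → ℝ} {p v : Pt n} {a b : ℝ}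

theorem HD.const (c : ℝ) : HD (fun _ : Pt n => c) p v 0 :=
  ⟨differentiableAt_const c, by simp⟩

theorem HD.coord (i : Fin n) : HD (fun q : Pt n => q i) p v (v i) := by
  have h : HasFDerivAt (fun q : Pt n => q i) (ContinuousLinearMap.proj (R := ℝ) (φ := fun _ : Fin n => ℝ) i) p :=
    hasFDerivAt_apply i p
  exact ⟨h.differentiableAt, by rw [h.fderiv]; rfl⟩

theorem HD.add (hf : HD f p v a) (hg : HD g p v b) : HD (fun q => f q + g q) p v (a + b) :=
  ⟨hf.1.add hg.1, by rw [fderiv_fun_add hf.1 hg.1]; simp [hf.2, hg.2]⟩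

theorem HD.sub (hf : HD f p v a) (hg : HD g p v b) : HD (fun q => f q - g q) p v (a - b) :=
  ⟨hf.1.sub hg.1, by rw [fderiv_fun_sub hf.1 hg.1]; simp [hf.2, hg.2]⟩

theorem HD.mul (hf : HD f p v a) (hg : HD g p v b) :
    HD (fun q => f q * g q) p v (a * g p + f p * b) :=
  ⟨hf.1.mul hg.1, by rw [fderiv_fun_mul hf.1 hg.1]; simp [hf.2, hg.2]; ring⟩

theorem HD.inv (hf : HD f p v a) (h0 : f p ≠ 0) :
    HD (fun q => (f q)⁻¹) p v (-a / f p ^ 2) := by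
  have h := (hasDerivAt_inv h0).comp_hasFDerivAt p hf.1.hasFDerivAt
  refine ⟨h.differentiableAt, ?_⟩
  have h2 := h.fderiv
  rw [show (fun q => (f q)⁻¹) = (Inv.inv ∘ f) from rfl, h2]
  simp [hf.2]; ring

theorem HD.congr (hf : HD f p v a) (h : g =ᶠ[nhds p] f) : HD g p v a :=
  ⟨hf.1.congr_of_eventuallyEq h, by rw [h.fderiv_eq, hf.2]⟩
end HDrules

theorem HD_F (m : ℝ) (p v : Pt 3) : HD (bcvF m) p v (2 * m * (p 0 * v 0 + p 1 * v 1)) := by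
  have h := (HD.const (p := p) (v := v) (1:ℝ)).add ((HD.const m).mul
    (((HD.coord 0).mul (HD.coord 0)).add ((HD.coord 1).mul (HD.coord 1))))
  have e : bcvF m = fun q : Pt 3 => 1 + m * (q 0 * q 0 + q 1 * q 1) := by
    funext q; simp only [bcvF]; ring
  rw [e]; convert h using 1; ring

/-- derivative of the contact form -/
def dω (m l : ℝ) (p v : Pt 3) : Pt 3 :=
  ![l * v 1 / (2 * bcvF m p) - l * p 1 * (m * (p 0 * v 0 + p 1 * v 1)) / bcvF m p ^ 2,
    -(l * v 0) / (2 * bcvF m p) + l * p 0 * (m * (p 0 * v 0 + p 1 * v 1)) / bcvF m p ^ 2, 0]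

theorem HD_ω (m l : ℝ) (p v : Pt 3) (hF : bcvF m p ≠ 0) (i : Fin 3) :
    HD (fun q => bcvω m l q i) p v (dω m l p v i) := by
  have hi := (HD_F m p v).inv hF
  fin_cases i
  · have h := ((HD.const (p := p) (v := v) (l / 2)).mul (HD.coord 1)).mul hi
    have e : (fun q => bcvω m l q 0) = fun q : Pt 3 => l / 2 * q 1 * (bcvF m q)⁻¹ := by
      funext q; simp [bcvω]; ring
    show HD (fun q => bcvω m l q 0) p v (dω m l p v 0)
    rw [e]; convert h using 1; simp [dω]; field_simp; ring
  · have h := ((HD.const (p := p) (v := v) (-l / 2)).mul (HD.coord 0)).mul hi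
    have e : (fun q => bcvω m l q 1) = fun q : Pt 3 => -l / 2 * q 0 * (bcvF m q)⁻¹ := by
      funext q; simp [bcvω]; ring
    show HD (fun q => bcvω m l q 1) p v (dω m l p v 1)
    rw [e]; convert h using 1; simp [dω]; field_simp; try ring
  · have h := (HD.const (p := p) (v := v) (1:ℝ))
    show HD (fun q => bcvω m l q 2) p v (dω m l p v 2)
    simpa [bcvω, dω] using h

theorem HD_met (m l : ℝ) (p v : Pt 3) (hF : bcvF m p ≠ 0) (i j : Fin 3) :
    HD (fun q => bcvMet m l q i j) p v
      ((if i = j ∧ (i : ℕ) < 2 then -4 * m * (p 0 * v 0 + p 1 * v 1) / bcvF m p ^ 3 else 0)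
        + (dω m l p v i * bcvω m l p j + bcvω m l p i * dω m l p v j)) := by
  have hi := (HD_F m p v).inv hF
  have h2 := (HD_ω m l p v hF i).mul (HD_ω m l p v hF j)
  have e : (fun q => bcvMet m l q i j) = fun q => (if i = j ∧ (i : ℕ) < 2 then (bcvF m q)⁻¹ * (bcvF m q)⁻¹ else 0) + bcvω m l q i * bcvω m l q j := by
    funext q; simp [bcvMet]; split_ifs <;> field_simp
  rw [e]
  refine HD.add ?_ h2
  split_ifs with hc
  · convert hi.mul hi using 1; field_simp; ring
  · exact HD.const 0

theorem met_inv (m l : ℝ) (p : Pt 3) (hF : bcvF m p ≠ 0) :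
    (bcvMet m l p)⁻¹ = !![bcvF m p ^ 2, 0, -(l * p 1 * bcvF m p) / 2;
      0, bcvF m p ^ 2, l * p 0 * bcvF m p / 2;
      -(l * p 1 * bcvF m p) / 2, l * p 0 * bcvF m p / 2, 1 + l ^ 2 * (p 0 ^ 2 + p 1 ^ 2) / 4] := by
  apply Matrix.inv_eq_right_inv
  ext i j
  fin_cases i <;> fin_cases j <;>
    simp [Matrix.mul_apply, Fin.sum_univ_three, bcvMet, bcvω] <;> field_simp <;> ring

/-- explicit Christoffel symbols of BCV -/
def Gam (m l : ℝ) (p : Pt 3) : Fin 3 → Fin 3 → Fin 3 → ℝ :=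
  let x := p 0
  let y := p 1
  let f := (bcvF m p)⁻¹
  ![![![-2 * m * x * f, (l ^ 2 / 4 - 2 * m) * y * f, 0],
      ![(l ^ 2 / 4 - 2 * m) * y * f, (2 * m - l ^ 2 / 2) * x * f, l / 2],
      ![0, l / 2, 0]],
    ![![(2 * m - l ^ 2 / 2) * y * f, (l ^ 2 / 4 - 2 * m) * x * f, -l / 2],
      ![(l ^ 2 / 4 - 2 * m) * x * f, -2 * m * y * f, 0],
      ![-l / 2, 0, 0]],
    ![![l * (4 * m - l ^ 2) / 4 * (x * y) * (f * f), - l * (4 * m - l ^ 2) / 8 * (x * x - y * y) * (f * f), - l ^ 2 / 4 * x * f],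
      ![- l * (4 * m - l ^ 2) / 8 * (x * x - y * y) * (f * f), - l * (4 * m - l ^ 2) / 4 * (x * y) * (f * f), - l ^ 2 / 4 * y * f],
      ![- l ^ 2 / 4 * x * f, - l ^ 2 / 4 * y * f, 0]]]

theorem chr_eq (m l : ℝ) (p : Pt 3) (hF : bcvF m p ≠ 0) (k i j : Fin 3) :
    christoffel (bcvMet m l) p k i j = Gam m l p k i j := by
  unfold christoffel
  rw [met_inv m l p hF]
  simp only [(HD_met m l p _ hF _ _).2]
  have hF' := hF
  fin_cases k <;> fin_cases i <;> fin_cases j <;>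
    simp [Fin.sum_univ_three, Gam, bcvω, dω, Pi.single_apply] <;> field_simp <;>
    (try simp only [bcvF]) <;> (try ring)

theorem HD.of {n : ℕ} {f : Pt n → ℝ} {p v : Pt n} {a b : ℝ} (h : HD f p v a) (e : a = b) :
    HD f p v b := e ▸ h

/-- bilinear form of the Christoffel symbols -/
def Gb (m l : ℝ) (p : Pt 3) (k : Fin 3) (v w : Pt 3) : ℝ :=
  ∑ i, ∑ j, Gam m l p k i j * v i * w j

theorem bcvF_cont (m : ℝ) (p : Pt 3) (hF : bcvF m p ≠ 0) : ∀ᶠ q in nhds p, bcvF m q ≠ 0 :=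
  (HD_F m p 0).1.continuousAt.eventually_ne hF

theorem cov_const (m l : ℝ) (v w p : Pt 3) (hF : bcvF m p ≠ 0) (k : Fin 3) :
    cov (bcvMet m l) (fun _ => v) (fun _ => w) p k = Gb m l p k v w := by
  simp [cov, Gb, chr_eq m l p hF]

/-- derivative of `Gam` -/
def dGam (m l : ℝ) (p v : Pt 3) : Fin 3 → Fin 3 → Fin 3 → ℝ :=
  let x := p 0
  let y := p 1
  let f := (bcvF m p)⁻¹
  let df := -(2 * m * (p 0 * v 0 + p 1 * v 1)) / bcvF m p ^ 2
  let dxf := v 0 * f + x * df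
  let dyf := v 1 * f + y * df
  ![![![-2 * m * dxf, (l ^ 2 / 4 - 2 * m) * dyf, 0],
      ![(l ^ 2 / 4 - 2 * m) * dyf, (2 * m - l ^ 2 / 2) * dxf, 0],
      ![0, 0, 0]],
    ![![(2 * m - l ^ 2 / 2) * dyf, (l ^ 2 / 4 - 2 * m) * dxf, 0],
      ![(l ^ 2 / 4 - 2 * m) * dxf, -2 * m * dyf, 0],
      ![0, 0, 0]],
    ![![l * (4 * m - l ^ 2) / 4 * (dxf * y * f + x * f * dyf), - l * (4 * m - l ^ 2) / 4 * (x * f * dxf - y * f * dyf), - l ^ 2 / 4 * dxf],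
      ![- l * (4 * m - l ^ 2) / 4 * (x * f * dxf - y * f * dyf), - l * (4 * m - l ^ 2) / 4 * (dxf * y * f + x * f * dyf), - l ^ 2 / 4 * dyf],
      ![- l ^ 2 / 4 * dxf, - l ^ 2 / 4 * dyf, 0]]]

set_option maxHeartbeats 1000000 in
theorem HD_Gam (m l : ℝ) (p v : Pt 3) (hF : bcvF m p ≠ 0) (k i j : Fin 3) :
    HD (fun q => Gam m l q k i j) p v (dGam m l p v k i j) := by
  have hi := (HD_F m p v).inv hF
  have hx := HD.coord (p := p) (v := v) 0
  have hy := HD.coord (p := p) (v := v) 1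
  have c := fun r : ℝ => HD.const (p := p) (v := v) r
  have A := fun r : ℝ => ((c r).mul hx).mul hi
  have B := fun r : ℝ => ((c r).mul hy).mul hi
  have C := fun r : ℝ => ((c r).mul (hx.mul hy)).mul (hi.mul hi)
  have D := fun r : ℝ => ((c r).mul ((hx.mul hx).sub (hy.mul hy))).mul (hi.mul hi)
  fin_cases k <;> fin_cases i <;> fin_cases j <;> skip <;>
  first
  | exact c _
  | (refine (A _).of ?_; simp [dGam]; ring; done)
  | (refine (B _).of ?_; simp [dGam]; ring; done)
  | (refine (C _).of ?_; simp [dGam]; ring; done)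
  | (refine (D _).of ?_; simp [dGam]; ring; done)

theorem HD_Gb (m l : ℝ) (p v w z : Pt 3) (hF : bcvF m p ≠ 0) (k : Fin 3) :
    HD (fun q => Gb m l q k w z) p v (∑ i, ∑ j, dGam m l p v k i j * w i * z j) := by
  simp only [Gb, Fin.sum_univ_three]
  have t := fun i j => (((HD_Gam m l p v hF k i j).mul (HD.const (w i))).mul (HD.const (z j)))
  have h := ((((t 0 0).add (t 0 1)).add (t 0 2)).add (((t 1 0).add (t 1 1)).add (t 1 2))).add
    (((t 2 0).add (t 2 1)).add (t 2 2))
  convert h using 1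
  ring

theorem curv_pre (m l : ℝ) (p v w z : Pt 3) (hF : bcvF m p ≠ 0) (k : Fin 3) :
    curvPt (bcvMet m l) p v w z k =
      (∑ i, ∑ j, dGam m l p v k i j * w i * z j) + Gb m l p k v (fun j => Gb m l p j w z)
      - ((∑ i, ∑ j, dGam m l p w k i j * v i * z j) + Gb m l p k w (fun j => Gb m l p j v z)) := by
  have key : ∀ v w : Pt 3, cov (bcvMet m l) (fun _ => v) (cov (bcvMet m l) (fun _ => w) (fun _ => z)) p k
      = (∑ i, ∑ j, dGam m l p v k i j * w i * z j) + Gb m l p k v (fun j => Gb m l p j w z) := by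
    intro v w
    have h : HD (fun q => cov (bcvMet m l) (fun _ => w) (fun _ => z) q k) p v _ :=
      (HD_Gb m l p v w z hF k).congr (by
        filter_upwards [bcvF_cont m p hF] with q hq
        exact cov_const m l w z q hq k)
    rw [cov, h.2]
    simp only [Gb, chr_eq m l p hF, cov_const m l w z p hF]
  have h0 : cov (bcvMet m l) (lieB (fun _ => v) (fun _ => w)) (fun _ => z) p k = 0 := by
    simp [cov, lieB]
  simp only [curvPt, curvOp, Pi.sub_apply, key, h0, sub_zero]


/-- the contact form as a functional -/
def om (m l : ℝ) (p v : Pt 3) : ℝ := l * (p 1 * v 0 - p 0 * v 1) / (2 * bcvF m p) + v 2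

theorem gip_eq (m l : ℝ) (p v w : Pt 3) :
    gip (bcvMet m l) p v w = (v 0 * w 0 + v 1 * w 1) / bcvF m p ^ 2 + om m l p v * om m l p w := by
  simp [gip, Fin.sum_univ_three, bcvMet, bcvω, om]; ring

set_option maxHeartbeats 4000000 in
theorem curv_eq (m l : ℝ) (p v w z : Pt 3) (hF : bcvF m p ≠ 0) (k : Fin 3) :
    curvPt (bcvMet m l) p v w z k =
      (4 * m - 3 * l ^ 2 / 4) * (gip (bcvMet m l) p w z * v k - gip (bcvMet m l) p v z * w k)
      - (4 * m - l ^ 2) * (om m l p w * om m l p z * v k - om m l p v * om m l p z * w k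
        + (gip (bcvMet m l) p w z * om m l p v - gip (bcvMet m l) p v z * om m l p w)
          * (![0, 0, 1] : Pt 3) k) := by
  rw [curv_pre m l p v w z hF]
  simp only [gip_eq, Gb, om, Fin.sum_univ_three]
  have hF' : bcvF m p = 1 + m * (p 0 ^ 2 + p 1 ^ 2) := rfl
  fin_cases k <;> simp [Gam, dGam] <;> field_simp <;> simp only [bcvF] <;> ring

theorem ricci_eq (m l : ℝ) (p v w : Pt 3) (hF : bcvF m p ≠ 0) :
    ricci (bcvMet m l) p v w = (4 * m - l ^ 2 / 2) * gip (bcvMet m l) p v w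
      - (4 * m - l ^ 2) * (om m l p v * om m l p w) := by
  simp only [ricci, curv_eq m l p _ _ _ hF, Fin.sum_univ_three]
  simp only [gip_eq, om, Pi.single_apply]
  simp
  field_simp
  ring

/-- second derivative of `x` -/
def X2 (m : ℝ) (x y x1 y1 κ : ℝ → ℝ) (s : ℝ) : ℝ :=
  -(κ s * y1 s) + 2 * m * (x s * (x1 s ^ 2 - y1 s ^ 2) + 2 * y s * x1 s * y1 s) / (1 + m * (x s ^ 2 + y s ^ 2))

/-- second derivative of `y` -/
def Y2 (m : ℝ) (x y x1 y1 κ : ℝ → ℝ) (s : ℝ) : ℝ :=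
  κ s * x1 s + 2 * m * (y s * (y1 s ^ 2 - x1 s ^ 2) + 2 * x s * x1 s * y1 s) / (1 + m * (x s ^ 2 + y s ^ 2))

/-- Unit-speed curve data. -/
structure Crv (m : ℝ) (x y x1 y1 κ : ℝ → ℝ) : Prop where
  pos : ∀ s, 0 < 1 + m * (x s ^ 2 + y s ^ 2)
  arc : ∀ s, x1 s ^ 2 + y1 s ^ 2 = (1 + m * (x s ^ 2 + y s ^ 2)) ^ 2
  dx : ∀ s, HasDerivAt x (x1 s) s
  dy : ∀ s, HasDerivAt y (y1 s) s
  dx1 : ∀ s, HasDerivAt x1 (X2 m x y x1 y1 κ s) s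
  dy1 : ∀ s, HasDerivAt y1 (Y2 m x y x1 y1 κ s) s

theorem HD.comp0 {f : ℝ → ℝ} {d : ℝ} {u v : Pt 2} (h : HasDerivAt f d (u 0)) :
    HD (fun q => f (q 0)) u v (d * v 0) := by
  have h1 : HasFDerivAt (fun q : Pt 2 => q 0) (ContinuousLinearMap.proj (R := ℝ) (φ := fun _ : Fin 2 => ℝ) 0) u :=
    hasFDerivAt_apply 0 u
  have h2 : HasFDerivAt (fun q : Pt 2 => f (q 0)) _ u := h.comp_hasFDerivAt u h1
  exact ⟨h2.differentiableAt, by rw [h2.fderiv]; simp⟩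

section crv
variable {m : ℝ} {x y x1 y1 κ : ℝ → ℝ} (l : ℝ)

/-- the parametrised Hopf cylinder -/
def hopf (x y : ℝ → ℝ) (u : Pt 2) : Pt 3 := ![x (u 0), y (u 0), u 1]

/-- the connection function -/
def wf (m l : ℝ) (x y x1 y1 : ℝ → ℝ) (s : ℝ) : ℝ :=
  l * (y s * x1 s - x s * y1 s) / (2 * (1 + m * (x s ^ 2 + y s ^ 2)))

/-- last component of the normal -/
def nf (m l : ℝ) (x y x1 y1 : ℝ → ℝ) (s : ℝ) : ℝ :=
  l * (x s * x1 s + y s * y1 s) / (2 * (1 + m * (x s ^ 2 + y s ^ 2)))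

/-- combination of the adapted frame with coefficients `a b c` -/
def fr (m l : ℝ) (x y x1 y1 a b c : ℝ → ℝ) (u : Pt 2) : Pt 3 :=
  ![a (u 0) * x1 (u 0) - b (u 0) * y1 (u 0),
    a (u 0) * y1 (u 0) + b (u 0) * x1 (u 0),
    c (u 0) - a (u 0) * wf m l x y x1 y1 (u 0) + b (u 0) * nf m l x y x1 y1 (u 0)]

theorem Crv.hF (h : Crv m x y x1 y1 κ) (u : Pt 2) : bcvF m (hopf x y u) ≠ 0 := by
  have := h.pos (u 0)
  exact this.ne'

theorem Crv.dF (h : Crv m x y x1 y1 κ) (s : ℝ) :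
    HasDerivAt (fun s => 2 * (1 + m * (x s ^ 2 + y s ^ 2))) (4 * m * (x s * x1 s + y s * y1 s)) s := by
  have := ((((h.dx s).pow 2).add ((h.dy s).pow 2)).const_mul m |>.const_add 1).const_mul 2
  refine HasDerivAt.congr_deriv this ?_
  simp; ring

theorem Crv.dw (h : Crv m x y x1 y1 κ) (s : ℝ) :
    HasDerivAt (wf m l x y x1 y1) (deriv (wf m l x y x1 y1) s) s := by
  have := h.pos s
  have h2 := (((((h.dy s).mul (h.dx1 s)).sub ((h.dx s).mul (h.dy1 s))).const_mul l).div (h.dF s) (by positivity))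
  exact h2.differentiableAt.hasDerivAt

theorem Crv.dw' (h : Crv m x y x1 y1 κ) (s : ℝ) :
    deriv (wf m l x y x1 y1) s =
     l * (y s * X2 m x y x1 y1 κ s - x s * Y2 m x y x1 y1 κ s) / (2 * (1 + m * (x s ^ 2 + y s ^ 2)))
      - l * (y s * x1 s - x s * y1 s) * m * (x s * x1 s + y s * y1 s) / (1 + m * (x s ^ 2 + y s ^ 2)) ^ 2 := by
  have hp := h.pos s
  have h2 := (((((h.dy s).mul (h.dx1 s)).sub ((h.dx s).mul (h.dy1 s))).const_mul l).div (h.dF s) (by positivity))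
  have h3 : HasDerivAt (wf m l x y x1 y1) _ s := h2
  rw [h3.deriv]
  simp only [Pi.sub_apply, Pi.mul_apply]
  field_simp
  ring

theorem Crv.dn (h : Crv m x y x1 y1 κ) (s : ℝ) :
    HasDerivAt (nf m l x y x1 y1)
     (l * (x1 s ^ 2 + y1 s ^ 2 + x s * X2 m x y x1 y1 κ s + y s * Y2 m x y x1 y1 κ s) / (2 * (1 + m * (x s ^ 2 + y s ^ 2)))
      - l * (x s * x1 s + y s * y1 s) * m * (x s * x1 s + y s * y1 s) / (1 + m * (x s ^ 2 + y s ^ 2)) ^ 2) s := by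
  have hp := h.pos s
  have h2 := (((((h.dx s).mul (h.dx1 s)).add ((h.dy s).mul (h.dy1 s))).const_mul l).div (h.dF s) (by positivity))
  have h3 : HasDerivAt (nf m l x y x1 y1) _ s := h2
  convert h3 using 1
  simp only [Pi.add_apply, Pi.mul_apply]
  field_simp
  ring

theorem Crv.dmap0 (h : Crv m x y x1 y1 κ) (u : Pt 2) :
    dmap (hopf x y) u 0 = ![x1 (u 0), y1 (u 0), 0] := by
  funext k
  fin_cases k
  · exact (HD.comp0 (v := Pi.single 0 1) (h.dx (u 0))).2.trans (by simp)
  · exact (HD.comp0 (v := Pi.single 0 1) (h.dy (u 0))).2.trans (by simp)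
  · exact (HD.coord (p := u) (v := Pi.single 0 1) 1).2.trans (by simp)

theorem Crv.dmap1 (h : Crv m x y x1 y1 κ) (u : Pt 2) :
    dmap (hopf x y) u 1 = ![0, 0, 1] := by
  funext k
  fin_cases k
  · exact (HD.comp0 (v := Pi.single 1 1) (h.dx (u 0))).2.trans (by simp)
  · exact (HD.comp0 (v := Pi.single 1 1) (h.dy (u 0))).2.trans (by simp)
  · exact (HD.coord (p := u) (v := Pi.single 1 1) 1).2.trans (by simp)

theorem Crv.HD_fr (h : Crv m x y x1 y1 κ) {a b c : ℝ → ℝ} {a' b' c' : ℝ} (u v : Pt 2)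
    (ha : HasDerivAt a a' (u 0)) (hb : HasDerivAt b b' (u 0)) (hc : HasDerivAt c c' (u 0)) (k : Fin 3) :
    HD (fun q => fr m l x y x1 y1 a b c q k) u v
    ((![a' * x1 (u 0) + a (u 0) * X2 m x y x1 y1 κ (u 0) - (b' * y1 (u 0) + b (u 0) * Y2 m x y x1 y1 κ (u 0)),
      a' * y1 (u 0) + a (u 0) * Y2 m x y x1 y1 κ (u 0) + (b' * x1 (u 0) + b (u 0) * X2 m x y x1 y1 κ (u 0)),
      c' - (a' * wf m l x y x1 y1 (u 0) + a (u 0) * deriv (wf m l x y x1 y1) (u 0))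
       + (b' * nf m l x y x1 y1 (u 0) + b (u 0) * deriv (nf m l x y x1 y1) (u 0))] : Pt 3) k * v 0) := by
  fin_cases k
  · exact HD.comp0 ((ha.mul (h.dx1 _)).sub (hb.mul (h.dy1 _)))
  · exact HD.comp0 ((ha.mul (h.dy1 _)).add (hb.mul (h.dx1 _)))
  · exact HD.comp0 ((hc.sub (ha.mul (h.dw l _))).add (hb.mul (h.dn l _).differentiableAt.hasDerivAt))

theorem Crv.cov1 (h : Crv m x y x1 y1 κ) {a b c : ℝ → ℝ} {a' b' c' : ℝ → ℝ}
    (ha : ∀ s, HasDerivAt a (a' s) s) (hb : ∀ s, HasDerivAt b (b' s) s) (hc : ∀ s, HasDerivAt c (c' s) s) :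
    covAlong (bcvMet m l) (hopf x y) (fr m l x y x1 y1 a b c) 1
      = fr m l x y x1 y1 (fun s => l / 2 * b s) (fun s => -(l / 2) * a s) (fun _ => 0) := by
  funext u k
  have hF := h.hF u
  simp only [covAlong, (h.HD_fr l u _ (ha _) (hb _) (hc _) k).2, chr_eq m l _ hF, h.dmap1]
  have hF2 := (h.pos (u 0)).ne'
  have hb : bcvF m (hopf x y u) = 1 + m * (x (u 0) ^ 2 + y (u 0) ^ 2) := rfl
  fin_cases k <;> simp [Fin.sum_univ_three, Gam, fr, hb, wf, nf] <;> (try simp [hopf]) <;> (try field_simp) <;> (try ring)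

theorem Crv.cov0 (h : Crv m x y x1 y1 κ) {a b c : ℝ → ℝ} {a' b' c' : ℝ → ℝ}
    (ha : ∀ s, HasDerivAt a (a' s) s) (hb : ∀ s, HasDerivAt b (b' s) s) (hc : ∀ s, HasDerivAt c (c' s) s) :
    covAlong (bcvMet m l) (hopf x y) (fr m l x y x1 y1 a b c) 0
      = fr m l x y x1 y1
        (fun s => a' s - κ s * b s + wf m l x y x1 y1 s * b s * (l / 2))
        (fun s => b' s + κ s * a s - l / 2 * c s - wf m l x y x1 y1 s * a s * (l / 2))
        (fun s => c' s + l / 2 * b s) := by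
  have key : (fun s => c' s + l / 2 * b s) =
      (fun s => c' s + l / 2 * b s * ((x1 s ^ 2 + y1 s ^ 2) / (1 + m * (x s ^ 2 + y s ^ 2)) ^ 2)) := by
    funext s
    have := (h.pos s).ne'
    rw [h.arc s, div_self (by positivity), mul_one]
  rw [key]
  funext u k
  have hF := h.hF u
  simp only [covAlong, (h.HD_fr l u _ (ha _) (hb _) (hc _) k).2, chr_eq m l _ hF, h.dmap0]
  have hF2 := (h.pos (u 0)).ne'
  have hb : bcvF m (hopf x y u) = 1 + m * (x (u 0) ^ 2 + y (u 0) ^ 2) := rfl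
  fin_cases k <;> simp [Fin.sum_univ_three, Gam, fr, hb, h.dw', (h.dn l _).deriv, wf, nf, X2, Y2] <;> (try simp [hopf]) <;> (try field_simp) <;> (try ring)
end crv

set_option linter.all false
section crv2
variable {m : ℝ} {x y x1 y1 κ : ℝ → ℝ} (l : ℝ)

theorem Crv.fff_eq (h : Crv m x y x1 y1 κ) (u : Pt 2) :
    fff (bcvMet m l) (hopf x y) u =
      !![1 + wf m l x y x1 y1 (u 0) ^ 2, wf m l x y x1 y1 (u 0); wf m l x y x1 y1 (u 0), 1] := by
  have hF2 := (h.pos (u 0)).ne'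
  have hb : bcvF m (hopf x y u) = 1 + m * (x (u 0) ^ 2 + y (u 0) ^ 2) := rfl
  have key : (x1 (u 0) * x1 (u 0) + y1 (u 0) * y1 (u 0)) / (1 + m * (x (u 0) ^ 2 + y (u 0) ^ 2)) ^ 2 = 1 := by
    rw [← pow_two, ← pow_two, h.arc, div_self (by positivity)]
  ext a b
  fin_cases a <;> fin_cases b <;> simp [fff, gip_eq, h.dmap0, h.dmap1, om, hb, key, wf] <;> simp [hopf]
  ring

theorem Crv.fff_inv (h : Crv m x y x1 y1 κ) (u : Pt 2) :
    (fff (bcvMet m l) (hopf x y) u)⁻¹ =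
      !![1, -wf m l x y x1 y1 (u 0); -wf m l x y x1 y1 (u 0), 1 + wf m l x y x1 y1 (u 0) ^ 2] := by
  rw [h.fff_eq]
  apply Matrix.inv_eq_right_inv
  ext i j
  fin_cases i <;> fin_cases j <;> simp [Matrix.mul_apply, Fin.sum_univ_two] <;> ring

theorem Crv.HD_fff (h : Crv m x y x1 y1 κ) (u v : Pt 2) (a b : Fin 2) :
    HD (fun q => fff (bcvMet m l) (hopf x y) q a b) u v
      (!![2 * wf m l x y x1 y1 (u 0) * deriv (wf m l x y x1 y1) (u 0), deriv (wf m l x y x1 y1) (u 0);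
        deriv (wf m l x y x1 y1) (u 0), 0] a b * v 0) := by
  have hw := h.dw l (u 0)
  simp only [h.fff_eq]
  fin_cases a <;> fin_cases b
  · exact (HD.comp0 ((hw.pow 2).const_add 1)).of (by simp)
  · exact HD.comp0 hw
  · exact HD.comp0 hw
  · exact (HD.const 1).of (by simp)

theorem Crv.chr_fff (h : Crv m x y x1 y1 κ) (u : Pt 2) (c a b : Fin 2) :
    christoffel (fff (bcvMet m l) (hopf x y)) u c a b =
      if c = 1 ∧ a = 0 ∧ b = 0 then deriv (wf m l x y x1 y1) (u 0) else 0 := by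
  unfold christoffel
  rw [h.fff_inv]
  simp only [(h.HD_fff l u _ _ _).2]
  fin_cases c <;> fin_cases a <;> fin_cases b <;> simp [Fin.sum_univ_two] <;> ring

theorem fr_one (u : Pt 2) : fr m l x y x1 y1 (fun _ => 0) (fun _ => 0) (fun _ => 1) u = ![0, 0, 1] := by
  simp [fr]

theorem Crv.dm0 (h : Crv m x y x1 y1 κ) :
    (fun u => dmap (hopf x y) u 0) = fr m l x y x1 y1 (fun _ => 1) (fun _ => 0) (wf m l x y x1 y1) := by
  funext u; rw [h.dmap0]; simp [fr]

theorem Crv.dm1 (h : Crv m x y x1 y1 κ) :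
    (fun u => dmap (hopf x y) u 1) = fr m l x y x1 y1 (fun _ => 0) (fun _ => 0) (fun _ => 1) := by
  funext u; rw [h.dmap1]; simp [fr]

theorem tension_cov (m l : ℝ) (φ : Pt 2 → Pt 3) (u : Pt 2) (k : Fin 3) :
    tension (bcvMet m l) φ u k = ∑ a, ∑ b, (fff (bcvMet m l) φ u)⁻¹ a b *
      (covAlong (bcvMet m l) φ (fun q => dmap φ q b) a u k
        - ∑ c, christoffel (fff (bcvMet m l) φ) u c a b * dmap φ u c k) := by
  simp only [tension, covAlong]
  refine Finset.sum_congr rfl fun a _ => Finset.sum_congr rfl fun b _ => ?_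
  ring

theorem Crv.tension_eq (h : Crv m x y x1 y1 κ) :
    tension (bcvMet m l) (hopf x y) = fr m l x y x1 y1 (fun _ => 0) κ (fun _ => 0) := by
  have c0 : ∀ r : ℝ, ∀ s, HasDerivAt (fun _ : ℝ => r) ((fun _ : ℝ => (0:ℝ)) s) s := fun r s => hasDerivAt_const s r
  funext u k
  rw [tension_cov]
  simp only [Fin.sum_univ_two, h.dm0 l, h.dm1 l, h.fff_inv, h.chr_fff,
    h.cov0 l (c0 1) (c0 0) (h.dw l), h.cov0 l (c0 0) (c0 0) (c0 1),
    h.cov1 l (c0 1) (c0 0) (h.dw l), h.cov1 l (c0 0) (c0 0) (c0 1)]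
  simp only [h.dmap0, h.dmap1]
  fin_cases k <;> simp [fr] <;> ring

theorem Crv.bitension_eq (h : Crv m x y x1 y1 κ) {κ1 κ2 : ℝ → ℝ}
    (h1 : ∀ s, HasDerivAt κ (κ1 s) s) (h2 : ∀ s, HasDerivAt κ1 (κ2 s) s) :
    bitension (bcvMet m l) (hopf x y) = fr m l x y x1 y1 (fun s => -(3 * κ s * κ1 s))
      (fun s => κ2 s - κ s ^ 3 + (4 * m - l ^ 2) * κ s) (fun s => l * κ1 s) := by
  have c0 : ∀ r : ℝ, ∀ s, HasDerivAt (fun _ : ℝ => r) ((fun _ : ℝ => (0:ℝ)) s) s := fun r s => hasDerivAt_const s r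
  have hT := h.tension_eq l
  have hw := h.dw l
  have D1 : covAlong (bcvMet m l) (hopf x y) (tension (bcvMet m l) (hopf x y)) 1
      = fr m l x y x1 y1 (fun s => l / 2 * κ s) (fun _ => 0) (fun _ => 0) := by
    rw [hT, h.cov1 l (c0 0) h1 (c0 0)]; simp
  have D0 : covAlong (bcvMet m l) (hopf x y) (tension (bcvMet m l) (hopf x y)) 0
      = fr m l x y x1 y1 (fun s => -(κ s * κ s) + wf m l x y x1 y1 s * κ s * (l / 2)) κ1
        (fun s => l / 2 * κ s) := by
    rw [hT, h.cov0 l (c0 0) h1 (c0 0)]; simp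
  have e1 : ∀ s, HasDerivAt (fun s => l / 2 * κ s) ((fun s => l / 2 * κ1 s) s) s :=
    fun s => (h1 s).const_mul _
  have e0 : ∀ s, HasDerivAt (fun s => -(κ s * κ s) + wf m l x y x1 y1 s * κ s * (l / 2))
      ((fun s => -(κ1 s * κ s + κ s * κ1 s) + (deriv (wf m l x y x1 y1) s * κ s + wf m l x y x1 y1 s * κ1 s) * (l / 2)) s) s :=
    fun s => ((h1 s).mul (h1 s)).neg.add (((hw s).mul (h1 s)).mul_const _)
  funext u k
  have hF := h.hF u
  have hF2 := (h.pos (u 0)).ne'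
  have hb : bcvF m (hopf x y u) = 1 + m * (x (u 0) ^ 2 + y (u 0) ^ 2) := rfl
  have G : ∀ a b, gip (bcvMet m l) (hopf x y u) (dmap (hopf x y) u a) (dmap (hopf x y) u b) =
      fff (bcvMet m l) (hopf x y) u a b := fun _ _ => rfl
  have oT : om m l (hopf x y u) (tension (bcvMet m l) (hopf x y) u) = 0 := by
    rw [hT]; simp [om, fr, hb, nf]; simp [hopf]; field_simp; ring
  have o0 : om m l (hopf x y u) (dmap (hopf x y) u 0) = wf m l x y x1 y1 (u 0) := by
    rw [h.dmap0]; simp [om, hb, wf]; simp [hopf]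
  have o1 : om m l (hopf x y u) (dmap (hopf x y) u 1) = 1 := by
    rw [h.dmap1]; simp [om]
  have gT : ∀ b, gip (bcvMet m l) (hopf x y u) (tension (bcvMet m l) (hopf x y) u) (dmap (hopf x y) u b) = 0 := by
    intro b
    rw [gip_eq, oT, hT]
    fin_cases b
    · simp [h.dmap0, fr]; left; ring
    · simp [h.dmap1]
  simp only [bitension, Fin.sum_univ_two, D0, D1, h.cov0 l e0 h2 e1, h.cov1 l e0 h2 e1,
    h.cov0 l e1 (c0 0) (c0 0), h.cov1 l e1 (c0 0) (c0 0), curv_eq m l _ _ _ _ hF, gT, oT, o0, o1, G,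
    h.chr_fff, h.fff_inv]
  simp only [h.fff_eq, hT, h.dmap0, h.dmap1]
  fin_cases k <;> simp [fr] <;> ring
end crv2

theorem HD_base (m : ℝ) (p v : Pt 2) (hF : 1 + m * (p 0 ^ 2 + p 1 ^ 2) ≠ 0) (i j : Fin 2) :
    HD (fun q => bcvBase m q i j) p v
      (if i = j then -4 * m * (p 0 * v 0 + p 1 * v 1) / (1 + m * (p 0 ^ 2 + p 1 ^ 2)) ^ 3 else 0) := by
  have h := (HD.const (p := p) (v := v) (1:ℝ)).add ((HD.const m).mul
    (((HD.coord 0).mul (HD.coord 0)).add ((HD.coord 1).mul (HD.coord 1))))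
  have hF' : 1 + m * (p 0 * p 0 + p 1 * p 1) ≠ 0 := by convert hF using 3; ring
  have hi := h.inv hF'
  have e : (fun q => bcvBase m q i j) = fun q : Pt 2 => if i = j then
      (1 + m * (q 0 * q 0 + q 1 * q 1))⁻¹ * (1 + m * (q 0 * q 0 + q 1 * q 1))⁻¹ else 0 := by
    funext q; simp only [bcvBase, Matrix.of_apply]; split_ifs
    · rw [← mul_inv, one_div]; ring
    · rfl
  rw [e]
  split_ifs
  · refine (hi.mul hi).of ?_
    have : 1 + m * (p 0 * p 0 + p 1 * p 1) = 1 + m * (p 0 ^ 2 + p 1 ^ 2) := by ring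
    rw [this]
    field_simp
    ring
  · exact HD.const 0

theorem base_inv (m : ℝ) (p : Pt 2) (hF : 1 + m * (p 0 ^ 2 + p 1 ^ 2) ≠ 0) :
    (bcvBase m p)⁻¹ = !![(1 + m * (p 0 ^ 2 + p 1 ^ 2)) ^ 2, 0; 0, (1 + m * (p 0 ^ 2 + p 1 ^ 2)) ^ 2] := by
  apply Matrix.inv_eq_right_inv
  ext i j
  fin_cases i <;> fin_cases j <;> simp [Matrix.mul_apply, Fin.sum_univ_two, bcvBase, hF]

theorem geod_eq (m : ℝ) (α : ℝ → Pt 2) (s : ℝ) (hF : 1 + m * (α s 0 ^ 2 + α s 1 ^ 2) ≠ 0) (a b : ℝ)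
    (ha : deriv (fun t => deriv α t 0) s = a) (hb : deriv (fun t => deriv α t 1) s = b) :
    geodCurv m α s =
     ((a - 2 * m * (α s 0 * (deriv α s 0 ^ 2 - deriv α s 1 ^ 2) + 2 * α s 1 * deriv α s 0 * deriv α s 1)
        / (1 + m * (α s 0 ^ 2 + α s 1 ^ 2))) * (-deriv α s 1)
      + (b - 2 * m * (α s 1 * (deriv α s 1 ^ 2 - deriv α s 0 ^ 2) + 2 * α s 0 * deriv α s 0 * deriv α s 1)
        / (1 + m * (α s 0 ^ 2 + α s 1 ^ 2))) * deriv α s 0) / (1 + m * (α s 0 ^ 2 + α s 1 ^ 2)) ^ 2 := by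
  simp only [geodCurv, gip, christoffel, base_inv m _ hF, (HD_base m _ _ hF _ _).2, Fin.sum_univ_two]
  simp [bcvBase, ha, hb]
  field_simp
  ring

theorem acc_alg (m F x y p q a b κ : ℝ) (hF : F ≠ 0) (A : p ^ 2 + q ^ 2 = F ^ 2)
    (A2 : p * a + q * b = F * (2 * m * (x * p + y * q)))
    (hκ : κ = ((a - 2 * m * (x * (p ^ 2 - q ^ 2) + 2 * y * p * q) / F) * (-q)
      + (b - 2 * m * (y * (q ^ 2 - p ^ 2) + 2 * x * p * q) / F) * p) / F ^ 2) :
    a - 2 * m * (x * (p ^ 2 - q ^ 2) + 2 * y * p * q) / F = -(κ * q) ∧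
    b - 2 * m * (y * (q ^ 2 - p ^ 2) + 2 * x * p * q) / F = κ * p := by
  have hAA : p * (a - 2 * m * (x * (p ^ 2 - q ^ 2) + 2 * y * p * q) / F)
      + q * (b - 2 * m * (y * (q ^ 2 - p ^ 2) + 2 * x * p * q) / F) = 0 := by
    field_simp
    linear_combination F * A2 - 2 * m * (x * p + y * q) * A
  generalize a - 2 * m * (x * (p ^ 2 - q ^ 2) + 2 * y * p * q) / F = A0 at *
  generalize b - 2 * m * (y * (q ^ 2 - p ^ 2) + 2 * x * p * q) / F = A1 at *
  subst hκ
  constructor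
  · field_simp
    linear_combination -A0 * A + p * hAA
  · field_simp
    linear_combination -A1 * A + q * hAA

theorem crv_of (m : ℝ) (α : ℝ → Pt 2) (hα : ContDiff ℝ (⊤ : ℕ∞) α)
    (harc : ∀ s, gip (bcvBase m) (α s) (deriv α s) (deriv α s) = 1)
    (hdom : ∀ s, 0 < 1 + m * (α s 0 ^ 2 + α s 1 ^ 2)) :
    Crv m (fun s => α s 0) (fun s => α s 1) (fun s => deriv α s 0) (fun s => deriv α s 1)
      (geodCurv m α) ∧ ContDiff ℝ (⊤ : ℕ∞) (geodCurv m α) := by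
  have hd : ContDiff ℝ (⊤ : ℕ∞) (deriv α) := ((contDiff_infty_iff_deriv).1 hα).2
  have ci : ∀ i, ContDiff ℝ (⊤ : ℕ∞) (fun s => α s i) := fun i => contDiff_pi.1 hα i
  have c1 : ∀ i, ContDiff ℝ (⊤ : ℕ∞) (fun s => deriv α s i) := fun i => contDiff_pi.1 hd i
  have c2 : ∀ i, ContDiff ℝ (⊤ : ℕ∞) (deriv (fun s => deriv α s i)) :=
    fun i => ((contDiff_infty_iff_deriv).1 (c1 i)).2
  have d1 : ∀ i s, HasDerivAt (fun s => α s i) (deriv α s i) s := fun i s =>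
    hasDerivAt_pi.1 ((hα.differentiable (by simp)).differentiableAt.hasDerivAt) i
  have d2 : ∀ i s, HasDerivAt (fun s => deriv α s i) (deriv (fun s => deriv α s i) s) s := fun i s =>
    (((c1 i).differentiable (by simp)).differentiableAt.hasDerivAt)
  have arc : ∀ s, deriv α s 0 ^ 2 + deriv α s 1 ^ 2 = (1 + m * (α s 0 ^ 2 + α s 1 ^ 2)) ^ 2 := by
    intro s
    have h := harc s
    have hp := hdom s
    simp [gip, Fin.sum_univ_two, bcvBase] at h
    field_simp at h
    exact h
  have arc2 : ∀ s, deriv α s 0 * deriv (fun s => deriv α s 0) s + deriv α s 1 * deriv (fun s => deriv α s 1) s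
      = (1 + m * (α s 0 ^ 2 + α s 1 ^ 2)) * (2 * m * (α s 0 * deriv α s 0 + α s 1 * deriv α s 1)) := by
    intro s
    have L := ((d2 0 s).pow 2).add ((d2 1 s).pow 2)
    have R := ((((((d1 0 s).pow 2).add ((d1 1 s).pow 2)).const_mul m).const_add 1).pow 2)
    have E : ((fun s => deriv α s 0) ^ 2 + (fun s => deriv α s 1) ^ 2) =
       ((fun s => 1 + m * ((fun s => α s 0) ^ 2 + (fun s => α s 1) ^ 2) s) ^ 2 : ℝ → ℝ) := by
      funext s; exact arc s
    rw [E] at L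
    have := L.unique R
    simp at this
    linarith
  have hκ := fun s => geod_eq m α s (hdom s).ne' _ _ rfl rfl
  refine ⟨⟨hdom, arc, d1 0, d1 1, fun s => ?_, fun s => ?_⟩, ?_⟩
  · refine (d2 0 s).congr_deriv ?_
    have := (acc_alg m _ _ _ _ _ _ _ _ (hdom s).ne' (arc s) (arc2 s) (hκ s)).1
    simp only [X2]
    linarith
  · refine (d2 1 s).congr_deriv ?_
    have := (acc_alg m _ _ _ _ _ _ _ _ (hdom s).ne' (arc s) (arc2 s) (hκ s)).2
    simp only [Y2]
    linarith
  · have : geodCurv m α = _ := funext hκ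
    rw [this]
    have hne : ∀ s, (1 + m * (α s 0 ^ 2 + α s 1 ^ 2)) ≠ 0 := fun s => (hdom s).ne'
    have hne2 : ∀ s, (1 + m * (α s 0 ^ 2 + α s 1 ^ 2)) ^ 2 ≠ 0 := fun s => pow_ne_zero 2 (hne s)
    have x0 := ci 0
    have y0 := ci 1
    have x1 := c1 0
    have y1 := c1 1
    have x2 := c2 0
    have y2 := c2 1
    fun_prop (disch := assumption)

theorem fr_zero {m l : ℝ} {x y x1 y1 κ : ℝ → ℝ} (h : Crv m x y x1 y1 κ) (a b c : ℝ → ℝ) :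
    (∀ u, fr m l x y x1 y1 a b c u = 0) ↔ ∀ s, a s = 0 ∧ b s = 0 ∧ c s = 0 := by
  constructor
  · intro H s
    have H := H ![s, 0]
    have h0 := congrFun H 0
    have h1 := congrFun H 1
    have h2 := congrFun H 2
    simp [fr] at h0 h1 h2
    have A := h.arc s
    have hne : (1 + m * (x s ^ 2 + y s ^ 2)) ^ 2 ≠ 0 := pow_ne_zero 2 (h.pos s).ne'
    have ha : a s = 0 := by
      apply (mul_eq_zero.1 (_ : a s * (1 + m * (x s ^ 2 + y s ^ 2)) ^ 2 = 0)).resolve_right hne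
      linear_combination -a s * A + x1 s * h0 + y1 s * h1
    have hb : b s = 0 := by
      apply (mul_eq_zero.1 (_ : b s * (1 + m * (x s ^ 2 + y s ^ 2)) ^ 2 = 0)).resolve_right hne
      linear_combination -b s * A + x1 s * h1 - y1 s * h0
    simp [ha, hb] at h2
    exact ⟨ha, hb, h2⟩
  · intro H u
    obtain ⟨ha, hb, hc⟩ := H (u 0)
    funext k
    fin_cases k <;> simp [fr, ha, hb, hc]

/-- Let `α(s) = (x(s), y(s))` be an arclength-parametrised curve in
`(ℝ², h)` with geodesic curvature `κ_g`, and let `Σ = ∪_s π⁻¹(α(s))` be its Hopf cylinder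
in `M³_{m,l}`, parametrised by `φ(s,t) = (x(s), y(s), t)`, with adapted frame
`X = (x'/F)E₁ + (y'/F)E₂`, `ξ = (y'/F)E₁ − (x'/F)E₂`, `V = E₃`.  Then
`Ric(ξ,ξ) = 4m − l²/2`, `Ric(ξ,X) = Ric(ξ,V) = 0`, the torsion of the fibres is
`τ_g = −⟨∇_X V, ξ⟩ = −l/2`, and `Σ` is biharmonic if and only if
`κ_g'' − κ_g³ + (4m − l²)κ_g = 0`, `3κ_g κ_g' = 0` and `−(l/2)κ_g' = 0`; hence either
`κ_g ≡ 0` (and `Σ` is minimal), or `κ_g` is constant with `κ_g² = 4m − l²`. -/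
theorem biharmonic_equation_for_hopf_cylinders_in_BCV
    (m l : ℝ) (α : ℝ → Pt 2) (hα : ContDiff ℝ (⊤ : ℕ∞) α)
    (harc : ∀ s, gip (bcvBase m) (α s) (deriv α s) (deriv α s) = 1)
    (hdom : ∀ s, 0 < 1 + m * (α s 0 ^ 2 + α s 1 ^ 2))
    (φ X ξ V : Pt 2 → Pt 3)
    (hφ : ∀ u, φ u = ![α (u 0) 0, α (u 0) 1, u 1])
    (hX : ∀ u, X u = (deriv α (u 0) 0 / bcvF m (φ u)) • bcvE m l 0 (φ u)
      + (deriv α (u 0) 1 / bcvF m (φ u)) • bcvE m l 1 (φ u))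
    (hξ : ∀ u, ξ u = (deriv α (u 0) 1 / bcvF m (φ u)) • bcvE m l 0 (φ u)
      - (deriv α (u 0) 0 / bcvF m (φ u)) • bcvE m l 1 (φ u))
    (hV : ∀ u, V u = bcvE m l 2 (φ u)) :
    (∀ u, ricci (bcvMet m l) (φ u) (ξ u) (ξ u) = 4 * m - l ^ 2 / 2) ∧
    (∀ u, ricci (bcvMet m l) (φ u) (ξ u) (X u) = 0) ∧
    (∀ u, ricci (bcvMet m l) (φ u) (ξ u) (V u) = 0) ∧
    (∀ u, -gip (bcvMet m l) (φ u)
        (cov (bcvMet m l) (fun _ => X u) (bcvE m l 2) (φ u)) (ξ u) = -(l / 2)) ∧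
    (IsBiharmonic (bcvMet m l) φ ↔ ∀ s,
      deriv (deriv (geodCurv m α)) s - geodCurv m α s ^ 3
          + (4 * m - l ^ 2) * geodCurv m α s = 0 ∧
      3 * geodCurv m α s * deriv (geodCurv m α) s = 0 ∧
      -(l / 2) * deriv (geodCurv m α) s = 0) ∧
    (IsBiharmonic (bcvMet m l) φ →
      ((∀ s, geodCurv m α s = 0) ∧ IsMinimal (bcvMet m l) φ) ∨
      (∃ κ₀ : ℝ, (∀ s, geodCurv m α s = κ₀) ∧ κ₀ ^ 2 = 4 * m - l ^ 2)) := by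
  obtain ⟨h, hκ⟩ := crv_of m α hα harc hdom
  have hφ' : φ = hopf (fun s => α s 0) (fun s => α s 1) := funext hφ
  subst hφ'
  obtain ⟨hκd, hκ'⟩ := contDiff_infty_iff_deriv.1 hκ
  have h1 : ∀ s, HasDerivAt (geodCurv m α) (deriv (geodCurv m α) s) s :=
    fun s => (hκd s).hasDerivAt
  have h2 : ∀ s, HasDerivAt (deriv (geodCurv m α)) (deriv (deriv (geodCurv m α)) s) s :=
    fun s => ((contDiff_infty_iff_deriv.1 hκ').1 s).hasDerivAt
  have hbi : IsBiharmonic (bcvMet m l) (hopf (fun s => α s 0) (fun s => α s 1)) ↔ ∀ s,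
      deriv (deriv (geodCurv m α)) s - geodCurv m α s ^ 3
          + (4 * m - l ^ 2) * geodCurv m α s = 0 ∧
      3 * geodCurv m α s * deriv (geodCurv m α) s = 0 ∧
      -(l / 2) * deriv (geodCurv m α) s = 0 := by
    unfold IsBiharmonic
    rw [h.bitension_eq l h1 h2, fr_zero h]
    refine forall_congr' fun s => ⟨fun ⟨p, q, r⟩ => ⟨q, by linarith, by linarith⟩,
      fun ⟨p, q, r⟩ => ⟨by linarith, p, by linarith⟩⟩
  have eF : ∀ u, bcvF m (hopf (fun s => α s 0) (fun s => α s 1) u)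
      = 1 + m * (α (u 0) 0 ^ 2 + α (u 0) 1 ^ 2) := fun u => rfl
  have xi : ∀ u, ξ u = ![deriv α (u 0) 1, -deriv α (u 0) 0,
      -(l * (α (u 0) 0 * deriv α (u 0) 0 + α (u 0) 1 * deriv α (u 0) 1)) /
        (2 * bcvF m (hopf (fun s => α s 0) (fun s => α s 1) u))] := by
    intro u
    have hF := h.hF u
    rw [hξ u]
    funext k
    fin_cases k <;> simp [bcvE, hF]
    simp only [hopf] at hF ⊢
    simp
    field_simp
    ring
  have eX : ∀ u, X u = ![deriv α (u 0) 0, deriv α (u 0) 1,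
      (l * (α (u 0) 0 * deriv α (u 0) 1 - α (u 0) 1 * deriv α (u 0) 0)) /
        (2 * bcvF m (hopf (fun s => α s 0) (fun s => α s 1) u))] := by
    intro u
    have hF := h.hF u
    rw [hX u]
    funext k
    fin_cases k <;> simp [bcvE, hF]
    simp only [hopf] at hF ⊢
    simp
    field_simp
    ring
  have eV : ∀ u, V u = ![0, 0, 1] := fun u => by rw [hV u]; rfl
  have oxi : ∀ u, om m l (hopf (fun s => α s 0) (fun s => α s 1) u) (ξ u) = 0 := by
    intro u
    rw [xi u]
    have hF := h.hF u
    simp [om]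
    generalize bcvF m (hopf (fun s => α s 0) (fun s => α s 1) u) = F at *
    simp [hopf]
    field_simp
    ring
  refine ⟨fun u => ?_, fun u => ?_, fun u => ?_, fun u => ?_, hbi, fun H => ?_⟩
  · have A := h.arc (u 0)
    have hF := h.hF u
    rw [ricci_eq _ _ _ _ _ hF, gip_eq, oxi, xi u]
    simp
    rw [← eF u] at A
    generalize bcvF m (hopf (fun s => α s 0) (fun s => α s 1) u) = F at *
    field_simp
    linear_combination (8 * m - l ^ 2) * A
  · rw [ricci_eq _ _ _ _ _ (h.hF u), gip_eq, oxi, xi u, eX u]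
    simp
    right; left; ring
  · rw [ricci_eq _ _ _ _ _ (h.hF u), gip_eq, oxi, xi u, eV u]
    simp
  · have A := h.arc (u 0)
    have hF := h.hF u
    have hc : cov (bcvMet m l) (fun _ => X u) (bcvE m l 2) (hopf (fun s => α s 0) (fun s => α s 1) u)
        = fun k => Gb m l (hopf (fun s => α s 0) (fun s => α s 1) u) k (X u) ![0, 0, 1] :=
      funext fun k => cov_const m l (X u) ![0, 0, 1] _ hF k
    rw [hc, gip_eq, oxi, xi u, eX u]
    simp [Gb, Gam, Fin.sum_univ_three]
    rw [← eF u] at A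
    generalize bcvF m (hopf (fun s => α s 0) (fun s => α s 1) u) = F at *
    field_simp
    linear_combination l * A
  · rw [hbi] at H
    have hsq : ∀ s t, geodCurv m α s ^ 2 = geodCurv m α t ^ 2 := by
      intro s t
      have hd : ∀ s, HasDerivAt (fun s => geodCurv m α s ^ 2) 0 s := fun s =>
        ((h1 s).pow 2).congr_deriv (by have := (H s).2.1; simp at this ⊢; exact this)
      exact is_const_of_deriv_eq_zero (fun s => (hd s).differentiableAt) (fun s => (hd s).deriv) s t
    by_cases h0 : geodCurv m α 0 = 0
    · left
      have hz : ∀ s, geodCurv m α s = 0 := fun s => by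
        have := hsq s 0
        rw [h0] at this
        simpa using this
      refine ⟨hz, ?_⟩
      unfold IsMinimal
      rw [h.tension_eq l, fr_zero h]
      exact fun s => ⟨rfl, hz s, rfl⟩
    · right
      have hne : ∀ s, geodCurv m α s ≠ 0 := fun s e => h0 (by
        have := hsq s 0
        rw [e] at this
        simpa using this.symm)
      have hd0 : ∀ s, deriv (geodCurv m α) s = 0 := fun s => by
        have := (H s).2.1
        simpa [hne s] using this
      have hdd : deriv (geodCurv m α) = fun _ => 0 := funext hd0
      refine ⟨geodCurv m α 0, fun s => is_const_of_deriv_eq_zero hκd hd0 s 0, ?_⟩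
      have := (H 0).1
      rw [hdd] at this
      simp at this
      apply mul_left_cancel₀ h0
      linarith
end
end
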